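/- For every n ≥ 5 and every k with 4 ≤ k ≤ n−1, the position of the Normal Domination Game on the path P_n = v_1 … v_n in which v_{k−1} is the only selected vertex has Grundy value ((k−3) % 4) ⊕ ((n−k) % 4) (it decomposes as the disjoint sum of the positions P'_{k−3} and P'_{n−k}). -/

import Mathlib

open SimpleGraph Finset

/-- A vertex `u` is dominated by the selected set `S` if it lies in the closed
neighborhood of some selected vertex. -/
def Dominated {V : Type} (G : SimpleGraph V) (S : Finset V) (u : V) : Prop :=
  ∃ s ∈ S, u = s ∨ G.Adj s u

/-- A vertex `v` is playable in position `S` if some vertex of the closed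
neighborhood of `v` is not dominated by `S`. -/
def Playable {V : Type} (G : SimpleGraph V) (S : Finset V) (v : V) : Prop :=
  ∃ u, (u = v ∨ G.Adj v u) ∧ ¬ Dominated G S u

lemma Playable.not_mem {V : Type} {G : SimpleGraph V} {S : Finset V} {v : V}
    (h : Playable G S v) : v ∉ S := by
  intro hv
  obtain ⟨u, hu, hnd⟩ := h
  exact hnd ⟨v, hv, hu.imp id (fun a => a)⟩

lemma Playable.card_lt {V : Type} [Fintype V] [DecidableEq V]
    {G : SimpleGraph V} {S : Finset V} {v : V} (h : Playable G S v) :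
    (Finset.univ \ insert v S).card < (Finset.univ \ S).card := by
  apply Finset.card_lt_card
  refine ⟨Finset.sdiff_subset_sdiff (le_refl _) (Finset.subset_insert v S), ?_⟩
  intro hsub
  have hv : v ∈ Finset.univ \ S := by simp [h.not_mem]
  have := hsub hv
  simp at this

/-- The Grundy value (nimber) of a position of the Normal Domination Game:
the minimum excludant (least natural number not attained) of the Grundy values
of the positions reachable in one move (i.e. by selecting a playable vertex). -/
noncomputable def grundy {V : Type} [Fintype V] [DecidableEq V]
    (G : SimpleGraph V) (S : Finset V) : ℕ :=
  sInf {m : ℕ |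
    m ∉ Set.range fun v : {v : V // Playable G S v} => grundy G (insert v.1 S)}
termination_by (Finset.univ \ S).card
decreasing_by exact v.2.card_lt

/-- The Grundy value of the part of a path strictly between two consecutive selected vertices
at distance `d`. -/
def gapValue (d : ℕ) : ℕ := (d - 3) % 4

/-- The nim-sum of the gap values over consecutive entries of a list. -/
def gapSum : List ℕ → ℕ
  | a :: b :: l => gapValue (b - a) ^^^ gapSum (b :: l)
  | _ => 0

lemma gapSum_append (l₁ : List ℕ) (a b : ℕ) (l₂ : List ℕ) :
    gapSum (l₁ ++ a :: b :: l₂) =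
      gapSum (l₁ ++ [a]) ^^^ (gapValue (b - a) ^^^ gapSum (b :: l₂)) := by
  induction l₁ with
  | nil => simp [gapSum]
  | cons c l ih =>
    cases l with
    | nil => simp [gapSum]
    | cons e l =>
      simp only [List.cons_append, gapSum] at ih ⊢
      rw [ih, Nat.xor_assoc]

/-- The nim-winning move: a smaller target can be reached by decreasing a single gap. -/
lemma exists_gap_of_lt_gapSum {l : List ℕ} {t : ℕ} (h : t < gapSum l) :
    ∃ l₁ a b l₂, l = l₁ ++ a :: b :: l₂ ∧
      gapSum (l₁ ++ [a]) ^^^ gapSum (b :: l₂) ^^^ t < gapValue (b - a) := by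
  induction l generalizing t with
  | nil => simp [gapSum] at h
  | cons c l ih =>
    cases l with
    | nil => simp [gapSum] at h
    | cons e l =>
      rw [gapSum] at h
      rcases Nat.lt_xor_cases h with h | h
      · refine ⟨[], c, e, l, rfl, ?_⟩
        simpa [gapSum, Nat.xor_comm] using h
      · obtain ⟨l₁, a, b, l₂, hl, hlt⟩ := ih h
        refine ⟨c :: l₁, a, b, l₂, by rw [hl]; rfl, ?_⟩
        have key : gapSum (c :: l₁ ++ [a]) = gapValue (e - c) ^^^ gapSum (l₁ ++ [a]) := by
          cases l₁ with
          | nil => obtain ⟨rfl, -⟩ := List.cons.inj hl; rfl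
          | cons f l₁ => obtain ⟨rfl, -⟩ := List.cons.inj hl; rfl
        rw [key]
        convert hlt using 1
        ac_rfl

lemma exists_gap_of_not_mem {l : List ℕ} (hl : l.Pairwise (· < ·)) {x p q : ℕ}
    (hp : p ∈ l) (hpx : p < x) (hq : q ∈ l) (hxq : x < q) (hx : x ∉ l) :
    ∃ l₁ a b l₂, l = l₁ ++ a :: b :: l₂ ∧ a < x ∧ x < b := by
  induction l generalizing p with
  | nil => simp at hp
  | cons c l ih =>
    have hc : c < x := by
      rcases List.mem_cons.1 hp with rfl | hp
      · exact hpx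
      · exact (List.rel_of_pairwise_cons hl hp).trans hpx
    have hq : q ∈ l := (List.mem_cons.1 hq).resolve_left (by omega)
    cases l with
    | nil => simp at hq
    | cons e l =>
      have hxe : x ≠ e := by rintro rfl; simp at hx
      rcases lt_or_gt_of_ne hxe with hxe | hxe
      · exact ⟨[], c, e, l, rfl, hc, hxe⟩
      · obtain ⟨l₁, a, b, l₂, h, ha, hb⟩ :=
          ih hl.of_cons (p := e) (by simp) hxe hq (fun h => hx (List.mem_cons_of_mem _ h))
        exact ⟨c :: l₁, a, b, l₂, by rw [h]; rfl, ha, hb⟩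

lemma not_mem_gap {l₁ l₂ : List ℕ} {a b x : ℕ}
    (hl : (l₁ ++ a :: b :: l₂).Pairwise (· < ·)) (ha : a < x) (hb : x < b) :
    x ∉ l₁ ++ a :: b :: l₂ := by
  intro hx
  simp only [List.pairwise_append, List.pairwise_cons, List.mem_cons, List.mem_append,
    forall_eq_or_imp] at hl hx
  grind

lemma pairwise_insert_gap {l₁ l₂ : List ℕ} {a b x : ℕ}
    (hl : (l₁ ++ a :: b :: l₂).Pairwise (· < ·)) (ha : a < x) (hb : x < b) :
    (l₁ ++ a :: x :: b :: l₂).Pairwise (· < ·) := by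
  simp only [List.pairwise_append, List.pairwise_cons, List.mem_cons,
    forall_eq_or_imp] at hl ⊢
  grind

lemma gapValue_xor_ne {p q : ℕ} (hp : 1 ≤ p) (hq : 1 ≤ q) (h : 4 ≤ p + q) :
    gapValue p ^^^ gapValue q ≠ gapValue (p + q) := by
  unfold gapValue
  have h₁ : (p - 3) % 4 < 4 := Nat.mod_lt _ (by norm_num)
  have h₂ : (q - 3) % 4 < 4 := Nat.mod_lt _ (by norm_num)
  have h₃ : (p + q - 3) % 4 < 4 := Nat.mod_lt _ (by norm_num)
  generalize hu : (p - 3) % 4 = u at *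
  generalize hv : (q - 3) % 4 = v at *
  generalize hw : (p + q - 3) % 4 = w at *
  interval_cases u <;> interval_cases v <;> interval_cases w <;> first | decide | (exfalso; omega)

lemma gapValue_eq_zero {p : ℕ} (hp : p ≤ 3) : gapValue p = 0 := by
  unfold gapValue
  omega

lemma exists_gapValue_sub_eq {d y : ℕ} (hy : y < gapValue d) :
    ∃ p, 1 ≤ p ∧ p ≤ 3 ∧ p + 3 ≤ d ∧ gapValue (d - p) = y := by
  unfold gapValue at *
  exact ⟨(d - 3) % 4 - y, by omega, by omega, by omega, by omega⟩

/-- `l` lists in increasing order the selected vertices of a path on `n` vertices, shifted by `2`,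
together with two virtual selected vertices that sit one step beyond the ends of the path. -/
structure IsMarking {n : ℕ} (S : Finset (Fin n)) (l : List ℕ) : Prop where
  sorted : l.Pairwise (· < ·)
  mem_iff : ∀ x, x ∈ l ↔ x = 0 ∨ x = n + 3 ∨ ∃ v ∈ S, v.val + 2 = x

namespace IsMarking

variable {n : ℕ} {S : Finset (Fin n)} {l l₁ l₂ : List ℕ} {a b : ℕ}

lemma add_two_mem_iff (h : IsMarking S l) (v : Fin n) : v.val + 2 ∈ l ↔ v ∈ S := by
  rw [h.mem_iff]
  constructor
  · rintro (h | h | ⟨w, hw, h⟩)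
    · omega
    · omega
    · rwa [show v = w from Fin.ext (by omega)]
  · exact fun hv => Or.inr (Or.inr ⟨v, hv, rfl⟩)

lemma le (h : IsMarking S l) {x : ℕ} (hx : x ∈ l) : x ≤ n + 3 := by
  rcases (h.mem_iff x).1 hx with h | h | ⟨w, -, h⟩ <;> omega

lemma dominated_iff (h : IsMarking S l) (u : Fin n) :
    Dominated (pathGraph n) S u ↔ u.val + 1 ∈ l ∨ u.val + 2 ∈ l ∨ u.val + 3 ∈ l := by
  constructor
  · rintro ⟨s, hs, rfl | hadj⟩
    · exact Or.inr (Or.inl ((h.add_two_mem_iff u).2 hs))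
    · have hmem := (h.add_two_mem_iff s).2 hs
      rcases pathGraph_adj.1 hadj with hsu | hsu
      · left
        rwa [show u.val + 1 = s.val + 2 by omega]
      · right; right
        rwa [show u.val + 3 = s.val + 2 by omega]
  · rintro (hu | hu | hu)
    · rcases (h.mem_iff _).1 hu with hu | hu | ⟨w, hw, hu⟩
      · omega
      · omega
      · exact ⟨w, hw, Or.inr (pathGraph_adj.2 (Or.inl (by omega)))⟩
    · exact ⟨u, (h.add_two_mem_iff u).1 hu, Or.inl rfl⟩
    · rcases (h.mem_iff _).1 hu with hu | hu | ⟨w, hw, hu⟩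
      · omega
      · omega
      · exact ⟨w, hw, Or.inr (pathGraph_adj.2 (Or.inr (by omega)))⟩

lemma playable_iff (h : IsMarking S (l₁ ++ a :: b :: l₂)) {v : Fin n}
    (ha : a < v.val + 2) (hb : v.val + 2 < b) :
    Playable (pathGraph n) S v ↔ 4 ≤ b - a := by
  have hle : b ≤ n + 3 := h.le (by simp)
  constructor
  · rintro ⟨u, hu, hnd⟩
    rw [h.dominated_iff, not_or, not_or] at hnd
    obtain ⟨h₁, h₂, h₃⟩ := hnd
    have huv : u.val = v.val ∨ v.val + 1 = u.val ∨ u.val + 1 = v.val := by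
      rcases hu with rfl | hu
      · exact Or.inl rfl
      · exact Or.inr (pathGraph_adj.1 hu)
    have hne {x y : ℕ} (hx : x ∉ l₁ ++ a :: b :: l₂) (hy : y ∈ l₁ ++ a :: b :: l₂) : x ≠ y := by
      rintro rfl
      exact hx hy
    have := hne h₁ (y := a) (by simp)
    have := hne h₂ (y := a) (by simp)
    have := hne h₃ (y := a) (by simp)
    have := hne h₁ (y := b) (by simp)
    have := hne h₂ (y := b) (by simp)
    have := hne h₃ (y := b) (by simp)
    omega
  · intro hab
    have key (u : Fin n) (hau : a < u.val + 1) (hub : u.val + 3 < b)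
        (huv : u = v ∨ v.val + 1 = u.val ∨ u.val + 1 = v.val) :
        Playable (pathGraph n) S v := by
      refine ⟨u, huv.imp_right pathGraph_adj.2, ?_⟩
      rw [h.dominated_iff, not_or, not_or]
      exact ⟨not_mem_gap h.sorted (by omega) (by omega),
        not_mem_gap h.sorted (by omega) (by omega), not_mem_gap h.sorted (by omega) (by omega)⟩
    by_cases h₁ : v.val + 1 = a
    · exact key ⟨v.val + 1, by omega⟩ (by simp; omega) (by simp; omega) (by simp)
    · by_cases h₂ : v.val + 3 = b
      · exact key ⟨v.val - 1, by omega⟩ (by simp; omega) (by simp; omega)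
          (Or.inr (Or.inr (by simp; omega)))
      · exact key v (by omega) (by omega) (Or.inl rfl)

lemma insert_gap (h : IsMarking S (l₁ ++ a :: b :: l₂)) {v : Fin n}
    (ha : a < v.val + 2) (hb : v.val + 2 < b) :
    IsMarking (insert v S) (l₁ ++ a :: (v.val + 2) :: b :: l₂) where
  sorted := pairwise_insert_gap h.sorted ha hb
  mem_iff x := by
    have hx := h.mem_iff x
    simp only [List.mem_append, List.mem_cons] at hx
    simp only [List.mem_append, List.mem_cons, Finset.mem_insert, exists_eq_or_imp]
    grind

/-- Every value smaller than that of a gap is reached by a move inside that gap. -/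
lemma exists_move (h : IsMarking S (l₁ ++ a :: b :: l₂)) (hS : S.Nonempty) {y : ℕ}
    (hy : y < gapValue (b - a)) :
    ∃ v : Fin n, a < v.val + 2 ∧ v.val + 2 < b ∧
      gapValue (v.val + 2 - a) ^^^ gapValue (b - (v.val + 2)) = y := by
  obtain ⟨p, hp₁, hp₃, hpd, hpy⟩ := exists_gapValue_sub_eq hy
  have hle : b ≤ n + 3 := h.le (by simp)
  by_cases ha : a = 0
  · have hb : b ≤ n + 1 := by
      rcases (h.mem_iff b).1 (by simp) with hb | hb | ⟨w, -, hb⟩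
      · omega
      · obtain ⟨w, hw⟩ := hS
        exact absurd ((h.add_two_mem_iff w).2 hw)
          (not_mem_gap h.sorted (by omega) (by omega))
      · omega
    refine ⟨⟨b - p - 2, by omega⟩, by simp; omega, by simp; omega, ?_⟩
    rw [show b - p - 2 + 2 - a = b - a - p by omega, show b - (b - p - 2 + 2) = p by omega,
      gapValue_eq_zero hp₃, hpy, Nat.xor_zero]
  · have ha : 2 ≤ a := by
      rcases (h.mem_iff a).1 (by simp) with ha | ha | ⟨w, -, ha⟩ <;> omega
    refine ⟨⟨a + p - 2, by omega⟩, by simp; omega, by simp; omega, ?_⟩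
    rw [show a + p - 2 + 2 - a = p by omega, show b - (a + p - 2 + 2) = b - a - p by omega,
      gapValue_eq_zero hp₃, hpy, Nat.zero_xor]

/-- The Grundy value of a position with at least one selected vertex on a path is the nim-sum of
its gap values. -/
theorem grundy_eq (h : IsMarking S l) (hS : S.Nonempty) :
    grundy (pathGraph n) S = gapSum l := by
  induction hc : (Finset.univ \ S).card using Nat.strong_induction_on generalizing S l with
  | _ c ih =>
    subst hc
    rw [grundy]
    refine IsLeast.csInf_eq ⟨?_, ?_⟩
    · rintro ⟨⟨v, hv⟩, hval⟩
      obtain ⟨l₁, a, b, l₂, rfl, ha, hb⟩ := exists_gap_of_not_mem h.sorted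
        (x := v.val + 2) ((h.mem_iff 0).2 (Or.inl rfl)) (by omega)
        ((h.mem_iff (n + 3)).2 (Or.inr (Or.inl rfl))) (by omega)
        (fun hm => hv.not_mem ((h.add_two_mem_iff v).1 hm))
      have hab := (h.playable_iff ha hb).1 hv
      simp only at hval
      rw [ih _ hv.card_lt (h.insert_gap ha hb) (Finset.insert_nonempty _ _) rfl,
        gapSum_append, gapSum_append, gapSum, ← Nat.xor_assoc (gapValue _), Nat.xor_right_inj,
        Nat.xor_left_inj] at hval
      refine gapValue_xor_ne (by omega) (by omega) (by omega) (hval.trans ?_)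
      congr 1
      omega
    · intro m hm
      by_contra! hlt
      obtain ⟨l₁, a, b, l₂, rfl, hy⟩ := exists_gap_of_lt_gapSum hlt
      obtain ⟨v, ha, hb, hvy⟩ := h.exists_move hS hy
      have hab : 4 ≤ b - a := by
        by_contra hab
        rw [gapValue_eq_zero (by omega)] at hy
        omega
      have hv := (h.playable_iff ha hb).2 hab
      refine hm ⟨⟨v, hv⟩, ?_⟩
      simp only
      rw [ih _ hv.card_lt (h.insert_gap ha hb) (Finset.insert_nonempty _ _) rfl,
        gapSum_append, gapSum, ← Nat.xor_assoc (gapValue _), hvy]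
      generalize gapSum (l₁ ++ [a]) = x
      generalize gapSum (b :: l₂) = z
      rw [show x ^^^ (x ^^^ z ^^^ m ^^^ z) = (x ^^^ x) ^^^ (z ^^^ z) ^^^ m by ac_rfl]
      simp

end IsMarking

theorem grundy_path_one_selected (n k : ℕ) (hn : 5 ≤ n) (hk₁ : 4 ≤ k)
    (hk₂ : k ≤ n - 1) :
    grundy (SimpleGraph.pathGraph n) {(⟨k - 2, by omega⟩ : Fin n)} =
      ((k - 3) % 4) ^^^ ((n - k) % 4) := by
  have h : IsMarking {(⟨k - 2, by omega⟩ : Fin n)} [0, k, n + 3] :=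
    ⟨by simp; omega, fun x => by simp; omega⟩
  rw [h.grundy_eq (Finset.singleton_nonempty _)]
  simp only [gapSum, gapValue, Nat.xor_zero]
  congr 2
  omega
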